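/- arXiv:2207.04505 — 6 statements merged into one kernel-verified Lean document; each statement's English description precedes it below -/
import Mathlib

section
/- Let G* be the counterexample digraph with vertex set {s, t, a, b, c1, c2, c3, c4, c5, b1, b2, b3, m1, m2} and three edge groups: the black edges I = {(s,a), (a,b), (b,t)}; the orange edges X = {(s,c1), (c1,c2), (c2,a), (a,m1), (m1,c3), (c3,c4), (c4,m2), (m2,c5), (c5,t)}; the blue edges Y = {(s,b1), (b1,m1), (m1,m2), (m2,b), (b,b2), (b2,b3), (b3,t)}. Assign weight 3 to each edge of I and weight 1 to each edge of X ∪ Y. For an edge set E' ⊆ I ∪ X ∪ Y let SP(E') denote the minimum total weight of a directed path from s to t using only edges in E'. Then SP(I) = 9, SP(I ∪ X) = 9, SP(I ∪ Y) = 7, and SP(I ∪ X ∪ Y) = 5; consequently SP(I) − SP(I ∪ X) < SP(I ∪ Y) − SP(I ∪ X ∪ Y), so the minimum-cost routing value is NOT supermodular with respect to path additions. -/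
/-- The vertex set of the counterexample digraph. -/
inductive V14 : Type
  | s | t | a | b | c1 | c2 | c3 | c4 | c5 | b1 | b2 | b3 | m1 | m2
  deriving DecidableEq

open V14

/-- The black edges `I = {(s,a), (a,b), (b,t)}`. -/
def blackEdges : Finset (V14 × V14) := {(s, a), (a, b), (b, t)}

/-- The orange edges
`X = {(s,c1), (c1,c2), (c2,a), (a,m1), (m1,c3), (c3,c4), (c4,m2), (m2,c5), (c5,t)}`. -/
def orangeEdges : Finset (V14 × V14) :=
  {(s, c1), (c1, c2), (c2, a), (a, m1), (m1, c3), (c3, c4), (c4, m2), (m2, c5), (c5, t)}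

/-- The blue edges
`Y = {(s,b1), (b1,m1), (m1,m2), (m2,b), (b,b2), (b2,b3), (b3,t)}`. -/
def blueEdges : Finset (V14 × V14) :=
  {(s, b1), (b1, m1), (m1, m2), (m2, b), (b, b2), (b2, b3), (b3, t)}

/-- Weight 3 on each black edge, weight 1 on every other edge
(in particular on each edge of `X ∪ Y`). -/
noncomputable def w (e : V14 × V14) : ℝ := if e ∈ blackEdges then 3 else 1

/-- A list of vertices is a directed `s`–`t` path in the edge set `E'` if its
consecutive pairs are edges of `E'`, all its vertices are distinct, it starts
at `s` and ends at `t`. -/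
def IsSTPath (E' : Finset (V14 × V14)) (l : List V14) : Prop :=
  l.Chain' (fun x y => (x, y) ∈ E') ∧ l.Nodup ∧
  l.head? = some V14.s ∧ l.getLast? = some V14.t

/-- The total weight of a path: the sum of the weights of its consecutive
edges. -/
noncomputable def pathWeight (l : List V14) : ℝ := ((l.zip l.tail).map w).sum

/-- `SP E'` is the minimum total weight of a directed `s`–`t` path using only
edges in `E'`. -/
noncomputable def SP (E' : Finset (V14 × V14)) : ℝ :=
  sInf { v : ℝ | ∃ l : List V14, IsSTPath E' l ∧ v = pathWeight l }

/-- A potential `d` that drops by at most the weight along each edge bounds the weight of a path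
from below by the potential difference of its endpoints. -/
theorem le_pathWeight_add_of_potential {E' : Finset (V14 × V14)} {d : V14 → ℕ}
    (hd : ∀ e ∈ E', d e.1 ≤ (if e ∈ blackEdges then 3 else 1) + d e.2) (l : List V14) (x y : V14)
    (hl : (x :: l).IsChain (fun x y => (x, y) ∈ E')) (hy : (x :: l).getLast? = some y) :
    (d x : ℝ) ≤ pathWeight (x :: l) + d y := by
  induction l generalizing x with
  | nil =>
    obtain rfl : x = y := by simpa using hy
    simp [pathWeight]
  | cons z l ih =>
    rw [List.isChain_cons_cons] at hl
    have htail := ih z hl.2 (by simpa using hy)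
    have hedge : (d x : ℝ) ≤ w (x, z) + d z := by
      unfold w
      exact_mod_cast hd _ hl.1
    have hsum : pathWeight (x :: z :: l) = w (x, z) + pathWeight (z :: l) := by
      simp [pathWeight]
    linarith

/-- A path together with a potential certifying its optimality determines `SP`. -/
theorem SP_eq_of_potential {E' : Finset (V14 × V14)} {d : V14 → ℕ} {p : List V14}
    (hd : ∀ e ∈ E', d e.1 ≤ (if e ∈ blackEdges then 3 else 1) + d e.2) (ht : d V14.t = 0)
    (hp : IsSTPath E' p) (hw : pathWeight p = d V14.s) : SP E' = d V14.s := by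
  refine IsLeast.csInf_eq ⟨⟨p, hp, hw.symm⟩, ?_⟩
  rintro _ ⟨l, ⟨hchain, -, hhead, hlast⟩, rfl⟩
  obtain ⟨l, rfl⟩ := List.head?_eq_some_iff.mp hhead
  simpa [ht] using le_pathWeight_add_of_potential hd l _ _ hchain hlast

/-- The distance to `t` in `I ∪ X`. -/
def blackOrangePotential : V14 → ℕ
  | s => 9 | c1 => 8 | c2 => 7 | a => 6 | m1 => 5 | c3 => 4 | c4 => 3 | b => 3 | m2 => 2 | c5 => 1
  | _ => 0

/-- The distance to `t` in `I ∪ Y`. -/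
def blackBluePotential : V14 → ℕ
  | s => 7 | b1 => 6 | a => 6 | m1 => 5 | m2 => 4 | b => 3 | b2 => 2 | b3 => 1
  | _ => 0

/-- The distance to `t` in `I ∪ X ∪ Y`. -/
def fullPotential : V14 → ℕ
  | c1 => 6 | s => 5 | c2 => 5 | b1 => 4 | a => 4 | c3 => 4 | m1 => 3 | b => 3 | c4 => 3 | m2 => 2
  | b2 => 2 | c5 => 1 | b3 => 1 | t => 0

/-- On the counterexample digraph: `SP(I) = 9`, `SP(I ∪ X) = 9`,
`SP(I ∪ Y) = 7`, `SP(I ∪ X ∪ Y) = 5`, and consequently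
`SP(I) − SP(I ∪ X) < SP(I ∪ Y) − SP(I ∪ X ∪ Y)`: the minimum-cost routing
value is NOT supermodular with respect to path additions. -/
theorem sp_not_supermodular :
    SP blackEdges = 9 ∧
    SP (blackEdges ∪ orangeEdges) = 9 ∧
    SP (blackEdges ∪ blueEdges) = 7 ∧
    SP (blackEdges ∪ orangeEdges ∪ blueEdges) = 5 ∧
    SP blackEdges - SP (blackEdges ∪ orangeEdges) <
      SP (blackEdges ∪ blueEdges) - SP (blackEdges ∪ orangeEdges ∪ blueEdges) := by
  have hI : SP blackEdges = 9 := by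
    refine SP_eq_of_potential (d := blackOrangePotential) (p := [s, a, b, t])
      (by decide) rfl (by unfold IsSTPath List.Chain'; decide) ?_
    simp [pathWeight, w, blackEdges, blackOrangePotential]
    norm_num
  have hIX : SP (blackEdges ∪ orangeEdges) = 9 := by
    refine SP_eq_of_potential (d := blackOrangePotential) (p := [s, a, b, t])
      (by decide) rfl (by unfold IsSTPath List.Chain'; decide) ?_
    simp [pathWeight, w, blackEdges, blackOrangePotential]
    norm_num
  have hIY : SP (blackEdges ∪ blueEdges) = 7 := by
    refine SP_eq_of_potential (d := blackBluePotential) (p := [s, b1, m1, m2, b, b2, b3, t])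
      (by decide) rfl (by unfold IsSTPath List.Chain'; decide) ?_
    simp [pathWeight, w, blackEdges, blackBluePotential]
    norm_num
  have hIXY : SP (blackEdges ∪ orangeEdges ∪ blueEdges) = 5 := by
    refine SP_eq_of_potential (d := fullPotential) (p := [s, b1, m1, m2, c5, t])
      (by decide) rfl (by unfold IsSTPath List.Chain'; decide) ?_
    simp [pathWeight, w, blackEdges, fullPotential]
    norm_num
  refine ⟨hI, hIX, hIY, hIXY, ?_⟩
  rw [hI, hIX, hIY, hIXY]
  norm_num
end

section
/- Let G* be the counterexample digraph with vertex set {s, t, a, b, c1, c2, c3, c4, c5, b1, b2, b3, m1, m2} and three edge groups: the black edges I = {(s,a), (a,b), (b,t)}; the orange edges X = {(s,c1), (c1,c2), (c2,a), (a,m1), (m1,c3), (c3,c4), (c4,m2), (m2,c5), (c5,t)}; the blue edges Y = {(s,b1), (b1,m1), (m1,m2), (m2,b), (b,b2), (b2,b3), (b3,t)}. Give every edge the Greenshields travel-time function c(x) = 1/(1 − x/10) (unit length, unit speed limit, capacity 10), and let the single commodity route demand 5 from s to t. For an edge set E' ⊆ I ∪ X ∪ Y, let P(E') be the (finite) set of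 directed s–t paths using only edges in E', call x : P(E') → ℝ feasible if x_p ≥ 0 for all p and ∑_p x_p = 5, let x_e = ∑_{p ∋ e} x_p be the induced edge flows, and define the system-optimal value V(E') as the infimum over feasible x of ∑_{e} x_e / (1 − x_e/10). Then V(I) = 30 and V(I) − V(I ∪ X) < V(I ∪ Y) − V(I ∪ X ∪ Y); hence the system-optimal total travel time is NOT supermodular with respect to path additions. -/
open V14

/-- The flow induced on edge `e` by a (finitely supported) path flow `x`:
the sum of the flows of the paths containing `e` as a consecutive pair. -/
noncomputable def edgeFlow (x : List V14 →₀ ℝ) (e : V14 × V14) : ℝ :=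
  ∑ l ∈ x.support, if e ∈ l.zip l.tail then x l else 0

/-- The system-optimal value `V(E')`: the infimum, over path flows `x` that
are nonnegative, supported on directed `s`–`t` paths of `E'`, and routing a
total demand of `5`, of the total travel time `∑ e x_e / (1 − x_e/10)`
(each edge carrying the Greenshields travel-time function
`c(x) = 1/(1 − x/10)`). -/
noncomputable def SOVal (E' : Finset (V14 × V14)) : ℝ :=
  sInf { v : ℝ | ∃ x : List V14 →₀ ℝ,
    (∀ l, 0 ≤ x l) ∧
    (∀ l ∈ x.support, IsSTPath E' l) ∧
    (∑ l ∈ x.support, x l) = 5 ∧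
    v = ∑ e ∈ E', edgeFlow x e / (1 - edgeFlow x e / 10) }

/-- `x` routes the total demand `5` along directed `s`–`t` paths of `E'`. -/
def IsFeasible (E' : Finset (V14 × V14)) (x : List V14 →₀ ℝ) : Prop :=
  (∀ l, 0 ≤ x l) ∧ (∀ l ∈ x.support, IsSTPath E' l) ∧ (∑ l ∈ x.support, x l) = 5

/-- The total travel time of the path flow `x`. -/
noncomputable def travelTime (E' : Finset (V14 × V14)) (x : List V14 →₀ ℝ) : ℝ :=
  ∑ e ∈ E', edgeFlow x e / (1 - edgeFlow x e / 10)

/-- Supporting lines of the convex function `y ↦ y / (1 - y / 10)`. -/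
theorem tangent_le {y : ℝ} (hy : y < 10) (r : ℝ) :
    r ^ 2 * y - 10 * (r - 1) ^ 2 ≤ y / (1 - y / 10) := by
  have hu : 0 < 1 - y / 10 := by linarith
  rw [le_div_iff₀ hu]
  nlinarith [sq_nonneg (r * (1 - y / 10) - 1)]

/-- The potential difference along a path is at most the total weight of its edges. -/
theorem potential_le_sum_weight {E' : Finset (V14 × V14)} {w : V14 × V14 → ℝ} {d : V14 → ℝ}
    (hd : ∀ e ∈ E', d e.2 - d e.1 ≤ w e) :
    ∀ (l : List V14) (u v : V14), l.IsChain (fun x y => (x, y) ∈ E') → l.Nodup →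
      l.head? = some u → l.getLast? = some v →
      d v - d u ≤ ∑ e ∈ E', if e ∈ l.zip l.tail then w e else 0
  | [], u, v, _, _, h, _ => by simp at h
  | [p], u, v, _, _, h, h' => by
    simp only [List.head?_cons, List.getLast?_singleton, Option.some.injEq] at h h'
    simp [← h, ← h']
  | p :: q :: l, u, v, hc, hn, h, h' => by
    simp only [List.head?_cons, Option.some.injEq] at h
    subst h
    rw [List.isChain_cons_cons] at hc
    have ih := potential_le_sum_weight hd (q :: l) q v hc.2 (List.nodup_cons.1 hn).2 rfl
      (by simpa using h')
    have hpq := hd _ hc.1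
    have hnot : (p, q) ∉ (q :: l).zip l := fun hm =>
      (List.nodup_cons.1 hn).1 (List.of_mem_zip hm).1
    have hsplit : (∑ e ∈ E', if e ∈ (p :: q :: l).zip (p :: q :: l).tail then w e else 0) =
        (∑ e ∈ E', if e = (p, q) then w e else 0) +
          ∑ e ∈ E', if e ∈ (q :: l).zip (q :: l).tail then w e else 0 := by
      rw [← Finset.sum_add_distrib]
      refine Finset.sum_congr rfl fun e _ => ?_
      by_cases he : e = (p, q)
      · subst he
        simp [hnot]
      · by_cases hm : e ∈ (q :: l).zip l <;> simp [he, hm]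
    rw [hsplit, Finset.sum_ite_eq' E' (p, q) w, if_pos hc.1]
    simp only at hpq
    linarith

theorem IsFeasible.edgeFlow_le {E' : Finset (V14 × V14)} {x : List V14 →₀ ℝ}
    (hx : IsFeasible E' x) (e : V14 × V14) : edgeFlow x e ≤ 5 := by
  rw [← hx.2.2]
  exact Finset.sum_le_sum fun l _ => by split_ifs <;> simp [hx.1 l]

/-- Weak duality: a potential `d` dominated by the slopes `r e ^ 2` bounds the travel time. -/
theorem IsFeasible.dual_le {E' : Finset (V14 × V14)} {x : List V14 →₀ ℝ}
    (hx : IsFeasible E' x) {r : V14 × V14 → ℝ} {d : V14 → ℝ}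
    (hd : ∀ e ∈ E', d e.2 - d e.1 ≤ r e ^ 2) :
    5 * (d t - d s) - ∑ e ∈ E', 10 * (r e - 1) ^ 2 ≤ travelTime E' x := by
  have htangent : ∑ e ∈ E', (r e ^ 2 * edgeFlow x e - 10 * (r e - 1) ^ 2) ≤ travelTime E' x :=
    Finset.sum_le_sum fun e _ => tangent_le (by linarith [hx.edgeFlow_le e]) _
  rw [Finset.sum_sub_distrib] at htangent
  have hswap : ∑ e ∈ E', r e ^ 2 * edgeFlow x e =
      ∑ l ∈ x.support, x l * ∑ e ∈ E', if e ∈ l.zip l.tail then r e ^ 2 else 0 := by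
    simp only [edgeFlow, Finset.mul_sum]
    rw [Finset.sum_comm]
    refine Finset.sum_congr rfl fun l _ => Finset.sum_congr rfl fun e _ => ?_
    split_ifs <;> ring
  have hpaths : 5 * (d t - d s) ≤ ∑ e ∈ E', r e ^ 2 * edgeFlow x e := by
    rw [hswap, ← hx.2.2, Finset.sum_mul]
    refine Finset.sum_le_sum fun l hl => mul_le_mul_of_nonneg_left ?_ (hx.1 l)
    obtain ⟨hc, hn, hs, ht⟩ := hx.2.1 l hl
    exact potential_le_sum_weight hd l s t hc hn hs ht
  linarith

theorem SOVal_eq (E' : Finset (V14 × V14)) :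
    SOVal E' = sInf (travelTime E' '' {x | IsFeasible E' x}) := by
  unfold SOVal
  congr 1
  ext v
  simp only [Set.mem_ofPred_eq, Set.mem_image, IsFeasible, travelTime, and_assoc, eq_comm]

theorem SOVal_le {E' : Finset (V14 × V14)} {x : List V14 →₀ ℝ} (hx : IsFeasible E' x) :
    SOVal E' ≤ travelTime E' x := by
  rw [SOVal_eq]
  refine csInf_le ⟨0, ?_⟩ (Set.mem_image_of_mem _ hx)
  rintro _ ⟨y, hy, rfl⟩
  simpa using IsFeasible.dual_le hy (r := 1) (d := 0) (by simp)

theorem dual_le_SOVal {E' : Finset (V14 × V14)} (hE : ∃ x, IsFeasible E' x)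
    {r : V14 × V14 → ℝ} {d : V14 → ℝ} (hd : ∀ e ∈ E', d e.2 - d e.1 ≤ r e ^ 2) :
    5 * (d t - d s) - ∑ e ∈ E', 10 * (r e - 1) ^ 2 ≤ SOVal E' := by
  rw [SOVal_eq]
  refine le_csInf (Set.Nonempty.image _ hE) ?_
  rintro _ ⟨y, hy, rfl⟩
  exact IsFeasible.dual_le hy hd

theorem edgeFlow_add (x y : List V14 →₀ ℝ) (e : V14 × V14) :
    edgeFlow (x + y) e = edgeFlow x e + edgeFlow y e :=
  Finsupp.sum_add_index' (h := fun (l : List V14) (v : ℝ) => if e ∈ l.zip l.tail then v else 0)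
    (by simp) (by intros; split_ifs <;> simp)

theorem edgeFlow_single (l : List V14) (v : ℝ) (e : V14 × V14) :
    edgeFlow (Finsupp.single l v) e = if e ∈ l.zip l.tail then v else 0 :=
  Finsupp.sum_single_index (h := fun (l : List V14) (v : ℝ) => if e ∈ l.zip l.tail then v else 0) (by simp)

theorem isFeasible_single_add_single {E' : Finset (V14 × V14)} {l l' : List V14} {v v' : ℝ}
    (hl : IsSTPath E' l) (hl' : IsSTPath E' l') (hv : 0 ≤ v) (hv' : 0 ≤ v') (h : v + v' = 5) :
    IsFeasible E' (Finsupp.single l v + Finsupp.single l' v') := by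
  refine ⟨fun k => ?_, fun k hk => ?_, ?_⟩
  · have h₁ : 0 ≤ Finsupp.single l v := Finsupp.single_nonneg.2 hv
    have h₂ : 0 ≤ Finsupp.single l' v' := Finsupp.single_nonneg.2 hv'
    exact add_nonneg (h₁ k) (h₂ k)
  · rcases Finset.mem_union.1 (Finsupp.support_add hk) with hk | hk
    · rwa [Finset.mem_singleton.1 (Finsupp.support_single_subset hk)]
    · rwa [Finset.mem_singleton.1 (Finsupp.support_single_subset hk)]
  · rw [← h]
    refine (Finsupp.sum_add_index' (h := fun _ v => v) (by simp) (by simp)).trans ?_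
    simp

theorem isSTPath_black {E' : Finset (V14 × V14)} (hE : blackEdges ⊆ E') :
    IsSTPath E' [s, a, b, t] := by
  have h : ∀ e ∈ blackEdges, e ∈ E' := hE
  simp only [blackEdges, Finset.mem_insert, Finset.mem_singleton, forall_eq_or_imp,
    forall_eq] at h
  refine ⟨?_, by decide, rfl, rfl⟩
  change List.IsChain _ _
  simp [h.1, h.2.1, h.2.2]

theorem isFeasible_black {E' : Finset (V14 × V14)} (hE : blackEdges ⊆ E') :
    IsFeasible E' (Finsupp.single [s, a, b, t] 5 + Finsupp.single [s, a, b, t] 0) :=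
  isFeasible_single_add_single (isSTPath_black hE) (isSTPath_black hE)
    (by norm_num) le_rfl (by norm_num)

theorem SOVal_black : SOVal blackEdges = 30 := by
  apply le_antisymm
  · refine (SOVal_le (isFeasible_black subset_rfl)).trans_eq ?_
    simp [travelTime, blackEdges, edgeFlow_single]
    norm_num
  · refine le_trans ?_ (dual_le_SOVal ⟨_, isFeasible_black subset_rfl⟩ (r := fun _ => 2)
      (d := fun | s => 0 | a => 4 | b => 8 | _ => 12)
      (by simp [blackEdges]; norm_num))
    simp [blackEdges]
    norm_num

theorem le_SOVal_black_orange : 29 ≤ SOVal (blackEdges ∪ orangeEdges) := by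
  refine le_trans ?_ (dual_le_SOVal ⟨_, isFeasible_black Finset.subset_union_left⟩
    (r := fun e => if e ∈ blackEdges then 9 / 5 else 26 / 25)
    (d := fun
      | s => 0 | c1 => 27 / 25 | c2 => 54 / 25 | a => 81 / 25 | m1 => 108 / 25
      | c3 => 135 / 25 | c4 => 162 / 25 | b => 162 / 25 | m2 => 189 / 25 | c5 => 216 / 25
      | _ => 243 / 25)
    (by simp [blackEdges, orangeEdges]; norm_num))
  rw [Finset.sum_union (by decide)]
  simp [blackEdges, orangeEdges]
  norm_num

theorem le_SOVal_black_blue : 27 ≤ SOVal (blackEdges ∪ blueEdges) := by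
  refine le_trans ?_ (dual_le_SOVal ⟨_, isFeasible_black Finset.subset_union_left⟩
    (r := fun e => if e ∈ blackEdges then if e.2 = t then 9 / 5 else 8 / 5 else
      if e.1 ∈ [b, b2, b3] then 26 / 25 else 57 / 50)
    (d := fun
      | s => 0 | b1 => 32 / 25 | m1 => 64 / 25 | a => 64 / 25 | m2 => 96 / 25
      | b => 128 / 25 | b2 => 155 / 25 | b3 => 182 / 25 | _ => 209 / 25)
    (by simp [blackEdges, blueEdges]; norm_num))
  rw [Finset.sum_union (by decide)]
  simp [blackEdges, blueEdges]
  norm_num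

theorem SOVal_union_lt : SOVal (blackEdges ∪ orangeEdges ∪ blueEdges) < 26 := by
  have hp : IsSTPath (blackEdges ∪ orangeEdges ∪ blueEdges) [s, b1, m1, m2, c5, t] := by
    refine ⟨?_, by decide, rfl, rfl⟩
    change List.IsChain _ _
    simp [blackEdges, orangeEdges, blueEdges]
  have hblack : blackEdges ⊆ blackEdges ∪ orangeEdges ∪ blueEdges := by decide
  refine (SOVal_le (isFeasible_single_add_single (isSTPath_black hblack) hp
    (v := 4) (v' := 1) (by norm_num) (by norm_num) (by norm_num))).trans_lt ?_
  unfold travelTime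
  rw [Finset.sum_union (by decide), Finset.sum_union (by decide)]
  simp [blackEdges, orangeEdges, blueEdges, edgeFlow_add, edgeFlow_single]
  norm_num

/-- On the counterexample digraph with Greenshields costs `c(x) = 1/(1 − x/10)`
and demand `5` from `s` to `t`: `V(I) = 30` and
`V(I) − V(I ∪ X) < V(I ∪ Y) − V(I ∪ X ∪ Y)`; hence the system-optimal total
travel time is NOT supermodular with respect to path additions. -/
theorem soVal_not_supermodular :
    SOVal blackEdges = 30 ∧
    SOVal blackEdges - SOVal (blackEdges ∪ orangeEdges) <
      SOVal (blackEdges ∪ blueEdges) -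
        SOVal (blackEdges ∪ orangeEdges ∪ blueEdges) := by
  refine ⟨SOVal_black, ?_⟩
  linarith [SOVal_black, le_SOVal_black_orange, le_SOVal_black_blue, SOVal_union_lt]
end

section
/- Let d, l, v, u be positive reals and let n ≥ 1 and n_y ≥ 0 be natural numbers with d < n·u. Then d·l/(v·(1 − d/(n·u))) − d·l/(v·(1 − d/((n+1)·u))) ≥ d·l/(v·(1 − d/((n+n_y)·u))) − d·l/(v·(1 − d/((n+n_y+1)·u))). In words: when a demand d is split equally over n identical parallel Greenshields links of length l, speed limit v and capacity u, the decrease in total travel time obtained by adding one more identical parallel link exhibits diminishing returns in the number n of links already present; this establishes the supermodularity of the system-optimal (and user-equilibrium) total travel time with respect to identical parallel path additions. -/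
/-- Closed form of the decrease in total travel time when one more identical parallel link is
added to `x` of them. -/
theorem greenshields_decrease_eq {d l v u x : ℝ} (hd : 0 < d) (hu : 0 < u)
    (hx : d < x * u) :
    d * l / (v * (1 - d / (x * u))) - d * l / (v * (1 - d / ((x + 1) * u))) =
      d * l / v * (d * u / ((x * u - d) * ((x + 1) * u - d))) := by
  have total {y : ℝ} (hy : d < y * u) :
      d * l / (v * (1 - d / (y * u))) = d * l / v * (y * u / (y * u - d)) := by
    have h₁ : y * u ≠ 0 := (hd.trans hy).ne'
    rw [one_sub_div h₁, mul_div_assoc', div_div_eq_mul_div, mul_div_mul_comm]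
  have hx' : d < (x + 1) * u := by linarith
  have h₁ : x * u - d ≠ 0 := (sub_pos.2 hx).ne'
  have h₂ : (x + 1) * u - d ≠ 0 := (sub_pos.2 hx').ne'
  rw [total hx, total hx', ← mul_sub, div_sub_div _ _ h₁ h₂]
  ring

/-- Diminishing returns of identical parallel Greenshields path additions:
for demand `d`, length `l`, speed limit `v`, capacity `u` (all positive),
`n ≥ 1` links already present with `d < n·u`, and `n_y ≥ 0` further links,
the decrease in total travel time `d·l/(v·(1 − d/(n·u)))` obtained by adding
one more identical parallel link is at least the corresponding decrease when
`n + n_y` links are present. This is the supermodularity of the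
system-optimal (and user-equilibrium) total travel time with respect to
identical parallel path additions. -/
theorem greenshields_parallel_diminishing_returns
    (d l v u : ℝ) (hd : 0 < d) (hl : 0 < l) (hv : 0 < v) (hu : 0 < u)
    (n ny : ℕ) (hn : 1 ≤ n) (hdn : d < (n : ℝ) * u) :
    d * l / (v * (1 - d / ((n : ℝ) * u))) -
      d * l / (v * (1 - d / (((n : ℝ) + 1) * u))) ≥
    d * l / (v * (1 - d / (((n : ℝ) + (ny : ℝ)) * u))) -
      d * l / (v * (1 - d / (((n : ℝ) + (ny : ℝ) + 1) * u))) := by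
  have hle : (n : ℝ) * u ≤ ((n : ℝ) + ny) * u := by
    gcongr
    exact le_add_of_nonneg_right ny.cast_nonneg
  rw [greenshields_decrease_eq hd hu hdn,
    greenshields_decrease_eq hd hu (hdn.trans_le hle), ge_iff_le]
  have h₁ : 0 < (n : ℝ) * u - d := sub_pos.2 hdn
  have h₂ : 0 < ((n : ℝ) + 1) * u - d := by linarith
  have h₃ : ((n : ℝ) + 1) * u - d ≤ ((n : ℝ) + ny + 1) * u - d := by linarith
  gcongr
  linarith
end

section
/- Let n ≥ 1 be a natural number, and let d ≥ 0 and l, v, u > 0 be reals with d < n·u. Consider assignments x : Fin n → ℝ with 0 ≤ x i < u for every i and ∑_i x i = d, and the total travel time objective ∑_i (x i)·l/(v·(1 − (x i)/u)). Then the infimum of this objective over all such assignments equals d·l/(v·(1 − d/(n·u))), and it is attained by the equal-split assignment x i = d/n for all i. In particular, the equal split is a system-optimal flow for n identical parallel Greenshields links. -/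
/-- The effective cost of a Greenshields link lies above each of its tangent lines. -/
theorem greenshields_effectiveCost_tangent_le {l v u a x : ℝ} (hl : 0 < l) (hv : 0 < v)
    (hu : 0 < u) (ha : a < u) (hx : x < u) :
    a * l / (v * (1 - a / u)) + l * u ^ 2 / (v * (u - a) ^ 2) * (x - a) ≤
      x * l / (v * (1 - x / u)) := by
  have hau : 0 < u - a := sub_pos.mpr ha
  have hxu : 0 < u - x := sub_pos.mpr hx
  have cost_eq : ∀ y, y < u → y * l / (v * (1 - y / u)) = y * l * u / (v * (u - y)) := by
    intro y hy
    have hyu : u - y ≠ 0 := (sub_pos.mpr hy).ne'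
    have h : 1 - y / u = (u - y) / u := by field_simp
    rw [h]
    field_simp
  have gap : x * l * u / (v * (u - x)) -
      (a * l * u / (v * (u - a)) + l * u ^ 2 / (v * (u - a) ^ 2) * (x - a)) =
        l * u ^ 2 * (x - a) ^ 2 / (v * (u - x) * (u - a) ^ 2) := by
    field_simp
    ring
  have gap_nonneg : 0 ≤ l * u ^ 2 * (x - a) ^ 2 / (v * (u - x) * (u - a) ^ 2) := by positivity
  rw [cost_eq a ha, cost_eq x hx]
  linarith

/-- For `n ≥ 1` identical parallel Greenshields links of length `l`, speed
limit `v` and capacity `u`, and a demand `d ≥ 0` with `d < n·u`: the infimum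
over assignments `x : Fin n → ℝ` with `0 ≤ x i < u` and `∑ i, x i = d` of the
total travel time `∑ i, x i · l/(v·(1 − x i/u))` equals
`d·l/(v·(1 − d/(n·u)))`, and it is attained by the equal-split assignment
`x i = d/n` (which is feasible and achieves this value). In particular the
equal split is a system-optimal flow. -/
theorem greenshields_equal_split_system_optimal
    (n : ℕ) (hn : 1 ≤ n) (d l v u : ℝ) (hd : 0 ≤ d)
    (hl : 0 < l) (hv : 0 < v) (hu : 0 < u) (hdn : d < (n : ℝ) * u) :
    sInf { y : ℝ | ∃ x : Fin n → ℝ,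
        (∀ i, 0 ≤ x i ∧ x i < u) ∧ (∑ i, x i = d) ∧
        y = ∑ i, x i * l / (v * (1 - x i / u)) } =
      d * l / (v * (1 - d / ((n : ℝ) * u))) ∧
    (0 ≤ d / (n : ℝ) ∧ d / (n : ℝ) < u) ∧
    (∑ _i : Fin n, (d / (n : ℝ)) * l / (v * (1 - (d / (n : ℝ)) / u))) =
      d * l / (v * (1 - d / ((n : ℝ) * u))) := by
  have hn0 : (0 : ℝ) < n := by exact_mod_cast hn
  have ha0 : 0 ≤ d / (n : ℝ) := by positivity
  have hau : d / (n : ℝ) < u := by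
    rw [div_lt_iff₀ hn0]
    linarith
  have hsum : (∑ _i : Fin n, (d / (n : ℝ)) * l / (v * (1 - (d / (n : ℝ)) / u))) =
      d * l / (v * (1 - d / ((n : ℝ) * u))) := by
    rw [Finset.sum_const, Finset.card_univ, Fintype.card_fin, nsmul_eq_mul, div_div,
      ← mul_div_assoc, ← mul_assoc, mul_div_cancel₀ _ hn0.ne']
  refine ⟨IsLeast.csInf_eq ⟨⟨fun _ => d / n, fun _ => ⟨ha0, hau⟩, ?_, hsum.symm⟩, ?_⟩,
    ⟨ha0, hau⟩, hsum⟩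
  · simp [mul_div_cancel₀ _ hn0.ne']
  · rintro y ⟨x, hx, hxd, rfl⟩
    have hdev : ∑ i, (x i - d / n) = 0 := by
      simp [hxd, mul_div_cancel₀ _ hn0.ne']
    have hle := Finset.sum_le_sum fun i (_ : i ∈ Finset.univ) =>
      greenshields_effectiveCost_tangent_le hl hv hu hau (hx i).2
    rwa [Finset.sum_add_distrib, ← Finset.mul_sum, hdev, mul_zero, add_zero, hsum] at hle
end

section
/- Let n ≥ 1, let c_1, …, c_n : ℝ → ℝ be continuous, nondecreasing functions, let d > 0, and suppose x* ∈ ℝ^n minimizes the Beckmann potential Φ(x) = ∑_{i=1}^n ∫_0^{x_i} c_i(t) dt over the simplex {x ∈ ℝ^n : x_i ≥ 0 for all i, ∑_i x_i = d}. Then x* satisfies the Wardrop equilibrium condition: for all indices i, j, if x*_i > 0 then c_i(x*_i) ≤ c_j(x*_j). -/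
open intervalIntegral

/-- Transferring an amount from index `i` to index `j` changes a separable sum only in these two
terms. -/
theorem sum_transfer_sub_sum {ι : Type*} [Fintype ι] [DecidableEq ι] (F : ι → ℝ → ℝ) (x : ι → ℝ)
    {i j : ι} (hij : i ≠ j) (a b : ℝ) :
    ∑ k, F k (Function.update (Function.update x i a) j b k) - ∑ k, F k (x k) =
      (F i a - F i (x i)) + (F j b - F j (x j)) := by
  rw [← Finset.sum_sub_distrib, Fintype.sum_eq_add i j hij]
  · simp [hij]
  · rintro k ⟨hki, hkj⟩
    simp [hki, hkj]

/-- The integral of a monotone function over `[a, b]` is at most `(b - a)` times its value at the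
right endpoint. -/
theorem Monotone.integral_le_sub_mul_right {f : ℝ → ℝ} (hf : Monotone f) {a b : ℝ} (hab : a ≤ b) :
    ∫ t in a..b, f t ≤ (b - a) * f b := by
  simpa using intervalIntegral.integral_mono_on (μ := MeasureTheory.volume) hab hf.intervalIntegrable
    (intervalIntegrable_const (c := f b)) fun t ht => hf ht.2

/-- The integral of a monotone function over `[a, b]` is at least `(b - a)` times its value at the
left endpoint. -/
theorem Monotone.sub_mul_left_le_integral {f : ℝ → ℝ} (hf : Monotone f) {a b : ℝ} (hab : a ≤ b) :
    (b - a) * f a ≤ ∫ t in a..b, f t := by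
  simpa using intervalIntegral.integral_mono_on (μ := MeasureTheory.volume) hab
    (intervalIntegrable_const (c := f a)) hf.intervalIntegrable fun t ht => hf ht.1

/-- Minimizers of the Beckmann potential satisfy the Wardrop equilibrium
condition: if `c_1, …, c_n : ℝ → ℝ` are continuous and nondecreasing link
travel-time functions, `d > 0`, and `x*` minimizes
`Φ(x) = ∑ i, ∫_0^{x_i} c_i(t) dt` over the simplex
`{x : ∀ i, 0 ≤ x_i, ∑ i x_i = d}`, then for all `i, j`, `x*_i > 0` implies
`c_i(x*_i) ≤ c_j(x*_j)`. -/
theorem beckmann_minimizer_is_wardrop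
    (n : ℕ) (hn : 1 ≤ n) (c : Fin n → ℝ → ℝ)
    (hcont : ∀ i, Continuous (c i)) (hmono : ∀ i, Monotone (c i))
    (d : ℝ) (hd : 0 < d)
    (xstar : Fin n → ℝ) (hx0 : ∀ i, 0 ≤ xstar i) (hxd : ∑ i, xstar i = d)
    (hmin : ∀ y : Fin n → ℝ, (∀ i, 0 ≤ y i) → ∑ i, y i = d →
      (∑ i, ∫ t in (0 : ℝ)..(xstar i), c i t) ≤
        ∑ i, ∫ t in (0 : ℝ)..(y i), c i t) :
    ∀ i j, 0 < xstar i → c i (xstar i) ≤ c j (xstar j) := by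
  intro i j hi
  by_contra! hlt
  have hij : i ≠ j := by
    rintro rfl
    exact lt_irrefl _ hlt
  obtain ⟨ε, hε, hεi, hεc⟩ :
      ∃ ε : ℝ, 0 < ε ∧ ε < xstar i ∧ c j (xstar j + ε) < c i (xstar i - ε) := by
    have hj : Continuous fun ε => c j (xstar j + ε) := (hcont j).comp (by fun_prop)
    have hi' : Continuous fun ε => c i (xstar i - ε) := (hcont i).comp (by fun_prop)
    have hev : ∀ᶠ ε in nhds (0 : ℝ), c j (xstar j + ε) < c i (xstar i - ε) :=
      hj.continuousAt.eventually_lt hi'.continuousAt (by simpa using hlt)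
    have hpos : ∀ᶠ ε in nhdsWithin (0 : ℝ) (Set.Ioi 0), 0 < ε := self_mem_nhdsWithin
    exact (hpos.and (((eventually_lt_nhds hi).and hev).filter_mono nhdsWithin_le_nhds)).exists
  have hsum := sum_transfer_sub_sum (fun _ t => t) xstar hij (xstar i - ε) (xstar j + ε)
  have hpot := sum_transfer_sub_sum (fun k s => ∫ t in (0 : ℝ)..s, c k t) xstar hij
    (xstar i - ε) (xstar j + ε)
  have hle := hmin (Function.update (Function.update xstar i (xstar i - ε)) j (xstar j + ε))
    (fun k => by
      simp only [Function.update_apply]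
      split_ifs
      · linarith [hx0 j]
      · linarith
      · exact hx0 k)
    (by linarith)
  have hint (k : Fin n) (a b : ℝ) : IntervalIntegrable (c k) MeasureTheory.volume a b :=
    (hcont k).intervalIntegrable a b
  have hI := integral_interval_sub_left (hint i 0 (xstar i)) (hint i 0 (xstar i - ε))
  have hJ := integral_interval_sub_left (hint j 0 (xstar j + ε)) (hint j 0 (xstar j))
  have hi_lower := (hmono i).sub_mul_left_le_integral (sub_le_self (xstar i) hε.le)
  have hj_upper := (hmono j).integral_le_sub_mul_right (le_add_of_nonneg_right hε.le : xstar j ≤ _)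
  rw [sub_sub_cancel] at hi_lower
  rw [add_sub_cancel_left] at hj_upper
  have hgain := mul_lt_mul_of_pos_left hεc hε
  linarith
end

section
/- Let n ≥ 1, let k_1, …, k_n : ℝ → ℝ be differentiable convex functions, let d > 0, and let x* be feasible (x*_i ≥ 0 for all i and ∑_i x*_i = d). Suppose x* satisfies the marginal-cost condition: for all indices i, j, if x*_i > 0 then k_i'(x*_i) ≤ k_j'(x*_j). Then x* is a global minimizer of the system cost ∑_{i=1}^n k_i(x_i) over the feasible set {x ∈ ℝ^n : x_i ≥ 0 for all i, ∑_i x_i = d}. -/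
/-- A convex function lies above its tangent lines. -/
lemma ConvexOn.add_deriv_mul_sub_le {S : Set ℝ} {f : ℝ → ℝ} {x y : ℝ} (hf : ConvexOn ℝ S f)
    (hx : x ∈ S) (hy : y ∈ S) (hfd : DifferentiableAt ℝ f x) :
    f x + deriv f x * (y - x) ≤ f y := by
  rcases lt_trichotomy x y with h | rfl | h
  · have hs := hf.deriv_le_slope hx hy h hfd
    rw [slope_def_field, le_div_iff₀ (sub_pos.2 h)] at hs
    linarith
  · simp
  · have hs := hf.slope_le_deriv hy hx h hfd
    rw [slope_def_field, div_le_iff₀ (sub_pos.2 h)] at hs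
    linarith

/-- Sufficiency of the marginal-cost condition for system optimality: if
`k_1, …, k_n : ℝ → ℝ` are differentiable convex effective-cost functions,
`d > 0`, and `x*` is feasible (`x*_i ≥ 0`, `∑ i x*_i = d`) and satisfies the
marginal-cost condition (`x*_i > 0` implies `k_i'(x*_i) ≤ k_j'(x*_j)` for all
`j`), then `x*` globally minimizes the system cost `∑ i, k_i(x_i)` over the
feasible set. -/
theorem marginal_cost_condition_implies_system_optimal
    (n : ℕ) (hn : 1 ≤ n) (k : Fin n → ℝ → ℝ)
    (hdiff : ∀ i, Differentiable ℝ (k i))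
    (hconv : ∀ i, ConvexOn ℝ Set.univ (k i))
    (d : ℝ) (hd : 0 < d)
    (xstar : Fin n → ℝ) (hx0 : ∀ i, 0 ≤ xstar i) (hxd : ∑ i, xstar i = d)
    (hmc : ∀ i j, 0 < xstar i → deriv (k i) (xstar i) ≤ deriv (k j) (xstar j)) :
    ∀ y : Fin n → ℝ, (∀ i, 0 ≤ y i) → ∑ i, y i = d →
      (∑ i, k i (xstar i)) ≤ ∑ i, k i (y i) := by
  intro y hy0 hyd
  obtain ⟨i, -, hi⟩ : ∃ i ∈ Finset.univ, 0 < xstar i :=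
    Finset.exists_lt_of_sum_lt (by simpa [hxd] using hd)
  have key : ∀ j, k j (xstar j) + deriv (k i) (xstar i) * (y j - xstar j) ≤ k j (y j) := by
    intro j
    have htan := (hconv j).add_deriv_mul_sub_le (Set.mem_univ (xstar j)) (Set.mem_univ (y j))
      (hdiff j _)
    rcases (hx0 j).eq_or_lt with h | h
    · have hle := mul_le_mul_of_nonneg_right (hmc i j hi)
        (show 0 ≤ y j - xstar j by rw [← h, sub_zero]; exact hy0 j)
      linarith
    · rwa [(hmc i j hi).antisymm (hmc j i h)]
  calc ∑ j, k j (xstar j)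
      = ∑ j, (k j (xstar j) + deriv (k i) (xstar i) * (y j - xstar j)) := by
        rw [Finset.sum_add_distrib, ← Finset.mul_sum, Finset.sum_sub_distrib, hxd, hyd]
        ring
    _ ≤ ∑ j, k j (y j) := Finset.sum_le_sum fun j _ => key j
end
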